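/- arXiv:2410.22193 — 3 statements merged into one kernel-verified Lean document; each statement's English description precedes it below -/
import Mathlib

section
/- Let h_l, h_r > 0 and q_l, q_r ∈ ℝ. Define h̄ = (h_l + h_r)/2 and the Roe average q̄ = h̄·(q_l·h_l^{-1/2} + q_r·h_r^{-1/2})/(h_l^{1/2} + h_r^{1/2}). Then −(q̄²/h̄²)·(h_r − h_l) + (2q̄/h̄)·(q_r − q_l) = q_r²/h_r − q_l²/h_l. -/
/-- Shallow water Roe averages: the `q²/h` part of the Rankine–Hugoniot
condition holds at the average state `(h̄, q̄)`, where `h̄ = (h_l + h_r)/2`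
and `q̄` is the Roe average of the momenta. -/
theorem sw_roe_average_momentum (hl hr ql qr : ℝ)
    (hhl : 0 < hl) (hhr : 0 < hr)
    (hb qb : ℝ)
    (hhb : hb = (hl + hr) / 2)
    (hqb : qb = hb * (ql / Real.sqrt hl + qr / Real.sqrt hr) /
      (Real.sqrt hl + Real.sqrt hr)) :
    -(qb ^ 2 / hb ^ 2) * (hr - hl) + (2 * qb / hb) * (qr - ql)
      = qr ^ 2 / hr - ql ^ 2 / hl := by
  have ha : 0 < √hl := Real.sqrt_pos.2 hhl
  have hb' : 0 < √hr := Real.sqrt_pos.2 hhr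
  have hb0 : hb ≠ 0 := by rw [hhb]; positivity
  have hu : qb / hb = (ql / √hl + qr / √hr) / (√hl + √hr) := by
    rw [hqb]; field_simp
  rw [← div_pow, mul_div_assoc, hu]
  clear hu hqb hhb
  generalize hl_eq : √hl = a at *
  generalize hr_eq : √hr = b at *
  obtain rfl : hl = a ^ 2 := by rw [← hl_eq, Real.sq_sqrt hhl.le]
  obtain rfl : hr = b ^ 2 := by rw [← hr_eq, Real.sq_sqrt hhr.le]
  field_simp
  ring
end

section
/- Let V : ℝ → ℝ be any function, τ > 0, V₀ ∈ ℝ, and define the pressure closure P(ρ) = (V₀ − V(ρ⁻¹))/(2τ). Let ρ_l, ρ_r > 0 with ρ_l ≠ ρ_r and q_l, q_r ∈ ℝ. Define ρ̄ = (ρ_l + ρ_r)/2, q̄ = ρ̄·(q_l·ρ_l^{-1/2} + q_r·ρ_r^{-1/2})/(ρ_l^{1/2} + ρ_r^{1/2}), and V̄ = (V(ρ_l⁻¹) − V(ρ_r⁻¹))/(2τ·(ρ_l − ρ_r)). Let Â be the 2×2 real matrix with rows (0, 1) and (−q̄²/ρ̄² − V̄, 2q̄/ρ̄). Then Â applied to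 the vector (ρ_r − ρ_l, q_r − q_l) equals (q_r − q_l, q_r²/ρ_r + P(ρ_r) − q_l²/ρ_l − P(ρ_l)); i.e., Â satisfies the Rankine–Hugoniot condition for the Payne–Whitham flux f(ρ, q) = (q, q²/ρ + P(ρ)). -/
/-- The Roe-averaged velocity `u` satisfies the momentum jump identity, in terms of the
square roots `a`, `b` of the densities. -/
lemma roe_velocity_jump (a b ql qr : ℝ) (ha : 0 < a) (hb : 0 < b) :
    -((ql / a + qr / b) / (a + b)) ^ 2 * (b ^ 2 - a ^ 2) +
        2 * ((ql / a + qr / b) / (a + b)) * (qr - ql) =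
      qr ^ 2 / b ^ 2 - ql ^ 2 / a ^ 2 := by
  have hab : a + b ≠ 0 := by positivity
  field_simp
  ring

/-- The Payne–Whitham Roe matrix satisfies the Rankine–Hugoniot condition for
the flux `f(ρ, q) = (q, q²/ρ + P(ρ))` with pressure
`P(ρ) = (V₀ − V(ρ⁻¹))/(2τ)`. -/
theorem pw_roe_matrix_rankine_hugoniot (V : ℝ → ℝ) (τ V₀ : ℝ) (hτ : 0 < τ)
    (ρl ρr ql qr : ℝ) (hρl : 0 < ρl) (hρr : 0 < ρr) (hne : ρl ≠ ρr) :
    (let P : ℝ → ℝ := fun ρ => (V₀ - V ρ⁻¹) / (2 * τ)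
     let ρb : ℝ := (ρl + ρr) / 2
     let qb : ℝ := ρb * (ql / Real.sqrt ρl + qr / Real.sqrt ρr) /
        (Real.sqrt ρl + Real.sqrt ρr)
     let Vb : ℝ := (V ρl⁻¹ - V ρr⁻¹) / (2 * τ * (ρl - ρr))
     let A : Matrix (Fin 2) (Fin 2) ℝ :=
       !![0, 1; -(qb ^ 2 / ρb ^ 2) - Vb, 2 * qb / ρb]
     A.mulVec ![ρr - ρl, qr - ql]
       = ![qr - ql, qr ^ 2 / ρr + P ρr - ql ^ 2 / ρl - P ρl]) := by
  intro P ρb qb Vb A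
  have hjump := roe_velocity_jump (Real.sqrt ρl) (Real.sqrt ρr) ql qr
    (Real.sqrt_pos.2 hρl) (Real.sqrt_pos.2 hρr)
  rw [Real.sq_sqrt hρl.le, Real.sq_sqrt hρr.le] at hjump
  set u := (ql / Real.sqrt ρl + qr / Real.sqrt ρr) / (Real.sqrt ρl + Real.sqrt ρr) with hu
  have hρb : ρb ≠ 0 := by positivity
  have hqb : qb = ρb * u := mul_div_assoc _ _ _
  have hpressure : -Vb * (ρr - ρl) = P ρr - P ρl := by
    have hsub : ρl - ρr ≠ 0 := sub_ne_zero.2 hne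
    simp only [Vb, P]
    field_simp
    ring
  have hsq : qb ^ 2 / ρb ^ 2 = u ^ 2 := by rw [hqb]; field_simp
  have hlin : 2 * qb / ρb = 2 * u := by rw [hqb]; field_simp
  ext i
  fin_cases i
  · simp [A, Matrix.mulVec, dotProduct, Fin.sum_univ_two]
  · simp only [A, Matrix.mulVec, dotProduct, Fin.sum_univ_two, hsq, hlin]
    simp
    linear_combination hjump + hpressure
end

section
/- Let v₀, γ, τ > 0 and β ∈ ℝ, and define the optimal velocity closure V_e(ρ) = v₀·(tanh(γ/ρ − β) + tanh(β))/(1 + tanh(β)). Let ρ_l, ρ_r > 0 with ρ_l ≠ ρ_r, let q_l, q_r ∈ ℝ, define ρ̄ = (ρ_l + ρ_r)/2, q̄ = ρ̄·(q_l·ρ_l^{-1/2} + q_r·ρ_r^{-1/2})/(ρ_l^{1/2} + ρ_r^{1/2}), V̄ = (V_e(ρ_l) − V_e(ρ_r))/(2τ·(ρ_l − ρ_r)), and let Â be the 2×2 real matrix with rows (0, 1) and (−q̄²/ρ̄² − V̄, 2q̄/ρ̄). Then trace(Â)² − 4·det(Â) = −4·V̄ = 2·v₀·(tanh(β − γ/ρ_r)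 − tanh(β − γ/ρ_l))/(τ·(1 + tanh(β))·(ρ_r − ρ_l)), and this quantity is nonnegative. -/
/-- The real hyperbolic tangent is strictly increasing. -/
theorem strictMono_real_tanh : StrictMono Real.tanh := by
  intro x y h
  rwa [← Real.artanh_lt_artanh_iff ⟨Real.neg_one_lt_tanh x, Real.tanh_lt_one x⟩
    ⟨Real.neg_one_lt_tanh y, Real.tanh_lt_one y⟩, Real.artanh_tanh, Real.artanh_tanh]

/-- The discriminant of the Payne–Whitham Roe matrix equals `−4V̄`, equals the
explicit tanh expression, and is nonnegative. -/
theorem pw_roe_matrix_discriminant (v₀ γ τ β : ℝ)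
    (hv₀ : 0 < v₀) (hγ : 0 < γ) (hτ : 0 < τ)
    (ρl ρr ql qr : ℝ) (hρl : 0 < ρl) (hρr : 0 < ρr) (hne : ρl ≠ ρr) :
    (let Ve : ℝ → ℝ := fun ρ =>
       v₀ * (Real.tanh (γ / ρ - β) + Real.tanh β) / (1 + Real.tanh β)
     let ρb : ℝ := (ρl + ρr) / 2
     let qb : ℝ := ρb * (ql / Real.sqrt ρl + qr / Real.sqrt ρr) /
        (Real.sqrt ρl + Real.sqrt ρr)
     let Vb : ℝ := (Ve ρl - Ve ρr) / (2 * τ * (ρl - ρr))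
     let A : Matrix (Fin 2) (Fin 2) ℝ :=
       !![0, 1; -(qb ^ 2 / ρb ^ 2) - Vb, 2 * qb / ρb]
     A.trace ^ 2 - 4 * A.det = -4 * Vb ∧
       -4 * Vb = 2 * v₀ * (Real.tanh (β - γ / ρr) - Real.tanh (β - γ / ρl)) /
          (τ * (1 + Real.tanh β) * (ρr - ρl)) ∧
       0 ≤ -4 * Vb) := by
  intro Ve ρb qb Vb A
  have hβ : 0 < 1 + Real.tanh β := by linarith [Real.neg_one_lt_tanh β]
  have hneg (ρ : ℝ) : Real.tanh (β - γ / ρ) = -Real.tanh (γ / ρ - β) := by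
    rw [← Real.tanh_neg, neg_sub]
  have hVb : -4 * Vb = 2 * v₀ * (Real.tanh (β - γ / ρr) - Real.tanh (β - γ / ρl)) /
      (τ * (1 + Real.tanh β) * (ρr - ρl)) := by
    have hlr : ρl - ρr ≠ 0 := sub_ne_zero.mpr hne
    have hrl : ρr - ρl ≠ 0 := sub_ne_zero.mpr hne.symm
    simp only [Vb, Ve, hneg]
    field_simp
    ring
  refine ⟨?_, hVb, ?_⟩
  · simp only [A, Matrix.trace_fin_two_of, Matrix.det_fin_two_of]
    ring_nf
  · rw [hVb]
    rcases lt_or_gt_of_ne hne with h | h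
    · have hdiv : γ / ρr < γ / ρl := div_lt_div_of_pos_left hγ hρl h
      have htanh := strictMono_real_tanh (sub_lt_sub_left hdiv β)
      have hsub := sub_pos.mpr h
      have htsub := sub_pos.mpr htanh
      positivity
    · have hdiv : γ / ρl < γ / ρr := div_lt_div_of_pos_left hγ hρr h
      have htanh := strictMono_real_tanh (sub_lt_sub_left hdiv β)
      exact div_nonneg_of_nonpos
        (mul_nonpos_of_nonneg_of_nonpos (by positivity) (sub_nonpos.mpr htanh.le))
        (mul_nonpos_of_nonneg_of_nonpos (by positivity) (sub_nonpos.mpr h.le))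
end
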